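/- Let D be a ℂ-linear subspace of M_{2×n}(ℂ) such that D_1 = {V ∈ D : rank V ≤ 1} is a subspace of the form D_1 = {αη* : η ∈ B} for a nonzero α ∈ ℂ² and a subspace B ⊆ ℂⁿ. Let p ∈ M_n(ℂ) be the orthogonal projection onto B and D_2 = D ∩ D_1^⊥. Then the orthogonal complement D^⊥ in M_{2×n}(ℂ) equals the span of the matrices of rank at most 1 contained in D^⊥ if and only if the subspace {a(1_n − p) : a ∈ D_2} contains no matrix of rank 1. -/

import Mathlib

open Matrix Kronecker
open scoped ComplexOrder

noncomputable section


/-- Orthogonal complement of a set of vectors in `ℂⁿ` w.r.t. the standard inner product. -/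
def vPerp {n : ℕ} (B : Submodule ℂ (Fin n → ℂ)) : Submodule ℂ (Fin n → ℂ) where
  carrier := {γ | ∀ η ∈ B, ∑ j, star (η j) * γ j = 0}
  add_mem' := by
    intro a b ha hb η hη
    have h1 := ha η hη
    have h2 := hb η hη
    simp only [Pi.add_apply, mul_add, Finset.sum_add_distrib]
    rw [h1, h2, add_zero]
  zero_mem' := by intro η hη; simp
  smul_mem' := by
    intro c a ha η hη
    have h := ha η hη
    simp only [Pi.smul_apply, smul_eq_mul]
    calc ∑ j, star (η j) * (c * a j) = c * ∑ j, star (η j) * a j := by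
          rw [Finset.mul_sum]; exact Finset.sum_congr rfl fun j _ => by ring
      _ = 0 := by rw [h, mul_zero]

/-- Orthogonal complement of a set of matrices w.r.t. the Hilbert–Schmidt inner product. -/
def hsPerp {m n : ℕ} (S : Set (Matrix (Fin m) (Fin n) ℂ)) :
    Submodule ℂ (Matrix (Fin m) (Fin n) ℂ) where
  carrier := {W | ∀ V ∈ S, ∑ i, ∑ j, star (V i j) * W i j = 0}
  add_mem' := by
    intro a b ha hb V hV
    have h1 := ha V hV
    have h2 := hb V hV
    simp only [Matrix.add_apply, mul_add, Finset.sum_add_distrib]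
    rw [h1, h2, add_zero]
  zero_mem' := by intro V hV; simp
  smul_mem' := by
    intro c a ha V hV
    have h := ha V hV
    simp only [Matrix.smul_apply, smul_eq_mul]
    calc ∑ i, ∑ j, star (V i j) * (c * a i j)
        = c * ∑ i, ∑ j, star (V i j) * a i j := by
          rw [Finset.mul_sum]
          exact Finset.sum_congr rfl fun i _ => by
            rw [Finset.mul_sum]; exact Finset.sum_congr rfl fun j _ => by ring
      _ = 0 := by rw [h, mul_zero]

/-- `p` is the orthogonal projection matrix onto the subspace `B` of `ℂⁿ`. -/
def IsOrthProjOnto {n : ℕ} (p : Matrix (Fin n) (Fin n) ℂ) (B : Submodule ℂ (Fin n → ℂ)) : Prop :=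
  p.IsHermitian ∧ p * p = p ∧ (∀ η ∈ B, p.mulVec η = η) ∧ (∀ η, p.mulVec η ∈ B)

theorem sum_star_mul_comm {m n : ℕ} {V W : Matrix (Fin m) (Fin n) ℂ}
    (h : ∑ i, ∑ j, star (V i j) * W i j = 0) : ∑ i, ∑ j, star (W i j) * V i j = 0 := by
  have h' := congrArg star h
  simpa [star_sum, mul_comm] using h'

theorem mem_hsPerp_singleton {m n : ℕ} {V W : Matrix (Fin m) (Fin n) ℂ} :
    W ∈ hsPerp {V} ↔ ∑ i, ∑ j, star (V i j) * W i j = 0 :=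
  ⟨fun h => h V rfl, fun h U hU => by rw [Set.mem_singleton_iff.mp hU]; exact h⟩

theorem sum_star_vecMulVec_mul {m n : ℕ} (u : Fin m → ℂ) (v : Fin n → ℂ)
    (M : Matrix (Fin m) (Fin n) ℂ) :
    ∑ i, ∑ j, star (vecMulVec u v i j) * M i j = (star u ᵥ* M) ⬝ᵥ star v := by
  simp only [dotProduct, vecMul, vecMulVec_apply, Finset.sum_mul, Pi.star_apply, star_mul']
  rw [Finset.sum_comm]
  exact Finset.sum_congr rfl fun j _ => Finset.sum_congr rfl fun i _ => by ring

theorem exists_mem_hsPerp_of_notMem {m n : ℕ} {S : Submodule ℂ (Matrix (Fin m) (Fin n) ℂ)}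
    {X : Matrix (Fin m) (Fin n) ℂ} (hX : X ∉ S) :
    ∃ W ∈ hsPerp (S : Set (Matrix (Fin m) (Fin n) ℂ)), W ∉ hsPerp {X} := by
  obtain ⟨f, hfX, hf⟩ := Submodule.exists_le_ker_of_notMem hX
  let W : Matrix (Fin m) (Fin n) ℂ := .of fun i j => star (f (single i j 1))
  have hW (V : Matrix (Fin m) (Fin n) ℂ) : ∑ i, ∑ j, star (W i j) * V i j = f V := by
    conv_rhs => rw [matrix_eq_sum_single V]
    simp only [map_sum]
    refine Finset.sum_congr rfl fun i _ => Finset.sum_congr rfl fun j _ => ?_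
    have : single i j (V i j) = V i j • single i j (1 : ℂ) := by simp
    rw [this, map_smul]
    simp [W, mul_comm]
  refine ⟨W, fun V hV => sum_star_mul_comm ((hW V).trans (hf hV)), fun h => hfX ?_⟩
  rw [← hW]
  exact sum_star_mul_comm (mem_hsPerp_singleton.mp h)

theorem eq_zero_of_rank_eq_zero {m n : ℕ} {M : Matrix (Fin m) (Fin n) ℂ} (h : M.rank = 0) :
    M = 0 := by
  have h0 : M.mulVecLin = 0 := LinearMap.range_eq_bot.mp (Submodule.finrank_eq_zero.mp h)
  exact ext_of_mulVec_single fun j => by rw [zero_mulVec]; exact LinearMap.congr_fun h0 (Pi.single j 1)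

theorem exists_eq_vecMulVec_of_rank_le_one {m n : ℕ} {M : Matrix (Fin m) (Fin n) ℂ}
    (h : M.rank ≤ 1) : ∃ u v, M = vecMulVec u v := by
  obtain ⟨⟨u, _⟩, hu⟩ := finrank_le_one_iff.mp h
  choose c hc using fun j => hu ⟨M.mulVecLin (Pi.single j 1), LinearMap.mem_range_self _ _⟩
  refine ⟨u, c, ?_⟩
  ext i j
  have := congrFun (congrArg Subtype.val (hc j)) i
  simp at this
  rw [vecMulVec_apply, ← this, mul_comm]

theorem exists_eq_vecMulVec_of_mul_eq {n : ℕ} {a : Fin 2 → ℂ} (ha : a ≠ 0)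
    {Y : Matrix (Fin 2) (Fin n) ℂ} (h : ∀ j, a 1 * Y 0 j = a 0 * Y 1 j) :
    ∃ r, Y = vecMulVec a r := by
  by_cases h0 : a 0 = 0
  · have h1 : a 1 ≠ 0 := fun h1 => ha (by ext i; fin_cases i <;> simp [h0, h1])
    refine ⟨fun j => Y 1 j / a 1, ?_⟩
    ext i j
    have := h j
    fin_cases i <;> simp [vecMulVec_apply, h0] at this ⊢
    · simpa [h1] using this
    · field_simp
  · refine ⟨fun j => Y 0 j / a 0, ?_⟩
    ext i j
    have := h j
    fin_cases i <;> simp [vecMulVec_apply] at this ⊢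
    · field_simp
    · field_simp
      linear_combination -this

theorem rank_le_one_of_vecMul_eq_zero {n : ℕ} {x : Fin 2 → ℂ} (hx : x ≠ 0)
    {Y : Matrix (Fin 2) (Fin n) ℂ} (h : x ᵥ* Y = 0) : Y.rank ≤ 1 := by
  obtain ⟨r, rfl⟩ := exists_eq_vecMulVec_of_mul_eq (a := ![-x 1, x 0]) (Y := Y)
    (fun h' => hx (by
      have h0 := congrFun h' 0
      have h1 := congrFun h' 1
      ext i
      fin_cases i <;> simp_all))
    (fun j => by
      have := congrFun h j
      simp [vecMul, dotProduct, Fin.sum_univ_two] at this ⊢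
      linear_combination this)
  exact rank_vecMulVec_le _ _

/-- `X` agrees with some element of `D` after multiplication by any row vector on the left. -/
def IsRowwiseIn {n : ℕ} (D : Submodule ℂ (Matrix (Fin 2) (Fin n) ℂ))
    (X : Matrix (Fin 2) (Fin n) ℂ) : Prop :=
  ∀ x : Fin 2 → ℂ, ∃ d ∈ D, x ᵥ* X = x ᵥ* d

theorem IsRowwiseIn.sub {n : ℕ} {D : Submodule ℂ (Matrix (Fin 2) (Fin n) ℂ)}
    {X Y : Matrix (Fin 2) (Fin n) ℂ} (hX : IsRowwiseIn D X) (hY : Y ∈ D) :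
    IsRowwiseIn D (X - Y) := fun x => by
  obtain ⟨d, hd, h⟩ := hX x
  exact ⟨d - Y, D.sub_mem hd hY, by rw [vecMul_sub, vecMul_sub, h]⟩

theorem IsRowwiseIn.mem_of_eq_span {n : ℕ} {D : Submodule ℂ (Matrix (Fin 2) (Fin n) ℂ)}
    {X : Matrix (Fin 2) (Fin n) ℂ} (hX : IsRowwiseIn D X)
    (hD : hsPerp (D : Set (Matrix (Fin 2) (Fin n) ℂ)) =
      Submodule.span ℂ {W | W ∈ hsPerp (D : Set (Matrix (Fin 2) (Fin n) ℂ)) ∧ W.rank ≤ 1}) :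
    X ∈ D := by
  by_contra hXD
  obtain ⟨W, hW, hWX⟩ := exists_mem_hsPerp_of_notMem hXD
  refine hWX ?_
  rw [hD] at hW
  refine Submodule.span_le.mpr ?_ hW
  rintro V ⟨hV, hr⟩
  obtain ⟨u, v, rfl⟩ := exists_eq_vecMulVec_of_rank_le_one hr
  obtain ⟨d, hd, h⟩ := hX (star u)
  refine mem_hsPerp_singleton.mpr (sum_star_mul_comm ?_)
  rw [sum_star_vecMulVec_mul, h, ← sum_star_vecMulVec_mul]
  exact sum_star_mul_comm (hV d hd)

theorem eq_span_of_forall_isRowwiseIn {n : ℕ} {D : Submodule ℂ (Matrix (Fin 2) (Fin n) ℂ)}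
    (hD : ∀ X, IsRowwiseIn D X → X ∈ D) :
    hsPerp (D : Set (Matrix (Fin 2) (Fin n) ℂ)) =
      Submodule.span ℂ {W | W ∈ hsPerp (D : Set (Matrix (Fin 2) (Fin n) ℂ)) ∧ W.rank ≤ 1} := by
  refine le_antisymm (fun W hW => ?_) (Submodule.span_le.mpr fun W hW => hW.1)
  by_contra hWS
  obtain ⟨X, hX, hXW⟩ := exists_mem_hsPerp_of_notMem hWS
  refine hXW (mem_hsPerp_singleton.mpr (sum_star_mul_comm (hW X (hD X fun x => ?_))))
  let S : Submodule ℂ (Fin n → ℂ) := D.map (vecMulBilin ℂ ℂ x)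
  by_contra! hx
  have hxS : x ᵥ* X ∉ S := by
    rintro ⟨d, hd, h⟩
    exact hx d hd h.symm
  obtain ⟨f, hfX, hf⟩ := Submodule.exists_le_ker_of_notMem hxS
  let v : Fin n → ℂ := fun j => star (f (Pi.single j 1))
  have hv (w : Fin n → ℂ) : w ⬝ᵥ star v = f w := by
    conv_rhs => rw [pi_eq_sum_univ' w]
    simp [dotProduct, v, map_sum]
  refine hfX ?_
  rw [← hv, ← star_star x, ← sum_star_vecMulVec_mul]
  refine hX _ (Submodule.subset_span ⟨fun d hd => sum_star_mul_comm ?_, rank_vecMulVec_le _ _⟩)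
  rw [sum_star_vecMulVec_mul, star_star, hv]
  exact hf ⟨d, hd, rfl⟩

/-- A pencil `A + t B` that is injective for all `t`, including `t = ∞`, has no nonzero vector
in the range of every `A + t B`, `t` finite. -/
theorem eq_zero_of_forall_exists_add_smul_eq {E F : Type*} [AddCommGroup E] [Module ℂ E]
    [FiniteDimensional ℂ E] [AddCommGroup F] [Module ℂ F] (A B : E →ₗ[ℂ] F)
    (hinj : ∀ (a b : ℂ) (e : E), a • A e + b • B e = 0 → (a = 0 ∧ b = 0) ∨ e = 0)
    (v : F) (hv : ∀ t : ℂ, ∃ e, A e + t • B e = v) : v = 0 := by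
  choose d hd using hv
  have hdep : ¬ LinearIndependent ℂ d := fun h =>
    not_finite_iff_infinite.mpr (inferInstance : Infinite ℂ) h.finite
  rw [linearIndependent_iff_notMem_span] at hdep
  push Not at hdep
  obtain ⟨t₀, ht₀⟩ := hdep
  set S := Submodule.span ℂ (d '' (Set.univ \ {t₀})) with hS
  obtain ⟨g, hg⟩ := LinearMap.exists_leftInverse_of_injective (A + t₀ • B)
    (LinearMap.ker_eq_bot'.mpr fun e he => by
      simpa using hinj 1 t₀ e (by simpa using he))
  have hg' (e : E) : g (A e + t₀ • B e) = e := by simpa using LinearMap.congr_fun hg e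
  have hBS : ∀ s ∈ S, ∃ s' ∈ S, A s' + t₀ • B s' = B s := by
    have : S ≤ (S.map (A + t₀ • B)).comap B := by
      refine Submodule.span_le.mpr ?_
      rintro _ ⟨t, ⟨-, ht⟩, rfl⟩
      have ht' : t₀ - t ≠ 0 := sub_ne_zero.mpr (Ne.symm ht)
      refine ⟨(t₀ - t)⁻¹ • (d t - d t₀), S.smul_mem _ (S.sub_mem
        (Submodule.subset_span ⟨t, ⟨trivial, ht⟩, rfl⟩) ht₀), ?_⟩
      have h : (A + t₀ • B) (d t - d t₀) = (t₀ - t) • B (d t) := by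
        have h1 : A (d t) = v - t • B (d t) := eq_sub_of_add_eq (hd t)
        have h2 : A (d t₀) = v - t₀ • B (d t₀) := eq_sub_of_add_eq (hd t₀)
        simp only [LinearMap.add_apply, LinearMap.smul_apply, map_sub, h1, h2]
        module
      rw [map_smul, h, smul_smul, inv_mul_cancel₀ ht', one_smul]
    exact fun s hs => this hs
  have hgS : ∀ s ∈ S, (g ∘ₗ B) s ∈ S := fun s hs => by
    obtain ⟨s', hs', h⟩ := hBS s hs
    rw [LinearMap.comp_apply, ← h, hg']
    exact hs'
  have hSbot : S = ⊥ := by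
    by_contra hne
    have : Nontrivial S := Submodule.nontrivial_iff_ne_bot.mpr hne
    obtain ⟨c, hc⟩ := Module.End.exists_eigenvalue ((g ∘ₗ B).restrict hgS)
    obtain ⟨⟨s, hs⟩, hsc⟩ := hc.exists_hasEigenvector
    have h1 : g (B s) = c • s := congrArg Subtype.val hsc.apply_eq_smul
    obtain ⟨s', -, h2⟩ := hBS s hs
    rw [← h2, hg'] at h1
    rw [h1, map_smul, map_smul] at h2
    have h3 : c • A s + (c * t₀ - 1) • B s = 0 := by
      rw [sub_smul, one_smul, ← sub_eq_zero.mpr h2]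
      module
    rcases hinj _ _ _ h3 with ⟨rfl, h⟩ | h
    · simp at h
    · exact hsc.2 (Subtype.ext h)
  rw [hSbot, Submodule.mem_bot] at ht₀
  simpa [ht₀] using (hd t₀).symm

theorem IsRowwiseIn.mem_of_forall_rank {n : ℕ} {E : Submodule ℂ (Matrix (Fin 2) (Fin n) ℂ)}
    (hE : ∀ e ∈ E, e.rank ≤ 1 → e = 0) {X : Matrix (Fin 2) (Fin n) ℂ} (hX : IsRowwiseIn E X) :
    X ∈ E := by
  obtain ⟨d, hdE, hd⟩ := hX ![0, 1]
  have hY := hX.sub hdE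
  have hY1 (j : Fin n) : (X - d) 1 j = 0 := by
    have := congrFun hd j
    simp [vecMul, dotProduct, Fin.sum_univ_two] at this
    simp [this]
  let row (i : Fin 2) : E →ₗ[ℂ] (Fin n → ℂ) :=
    { toFun e := (e : Matrix (Fin 2) (Fin n) ℂ) i
      map_add' _ _ := rfl
      map_smul' _ _ := rfl }
  have hrow (i : Fin 2) (e : E) (j : Fin n) :
      row i e j = (e : Matrix (Fin 2) (Fin n) ℂ) i j := rfl
  have hY0 : (X - d) 0 = 0 := by
    refine eq_zero_of_forall_exists_add_smul_eq (row 0) (row 1) (fun a b e he => ?_) _ fun t => ?_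
    · by_cases hab : ![a, b] = 0
      · exact .inl ⟨congrFun hab 0, congrFun hab 1⟩
      · refine .inr (Subtype.ext (hE e e.2 (rank_le_one_of_vecMul_eq_zero hab ?_)))
        ext j
        simpa [vecMul, dotProduct, Fin.sum_univ_two, hrow] using congrFun he j
    · obtain ⟨e, he, h⟩ := hY ![1, t]
      refine ⟨⟨e, he⟩, ?_⟩
      ext j
      have := congrFun h j
      simp only [vecMul, dotProduct, Fin.sum_univ_two, hY1] at this
      simpa [hrow] using this.symm
  have : X - d = 0 := by
    ext i j
    fin_cases i
    · exact congrFun hY0 j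
    · exact hY1 j
  rwa [sub_eq_zero.mp this]

theorem IsOrthProjOnto.star_mem_iff {n : ℕ} {p : Matrix (Fin n) (Fin n) ℂ}
    {B : Submodule ℂ (Fin n → ℂ)} (hp : IsOrthProjOnto p B) (r : Fin n → ℂ) :
    star r ∈ B ↔ r ᵥ* p = r := by
  have h : star (r ᵥ* p) = p *ᵥ star r := by rw [star_vecMul, hp.1]
  refine ⟨fun hr => star_injective (by rw [h, hp.2.2.1 _ hr]), fun hr => ?_⟩
  rw [← hr, h]
  exact hp.2.2.2 _

/-- `D^⊥` is spanned by its rank-at-most-one matrices iff the subspace `D₂(1-p)` contains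
no rank-one matrix. -/
theorem stmt6 (n : ℕ) (D : Submodule ℂ (Matrix (Fin 2) (Fin n) ℂ))
    (α : Fin 2 → ℂ) (hα : α ≠ 0) (B : Submodule ℂ (Fin n → ℂ))
    (hD1 : {V | V ∈ D ∧ V.rank ≤ 1} =
      {M : Matrix (Fin 2) (Fin n) ℂ | ∃ η ∈ B, M = vecMulVec α (star η)})
    (p : Matrix (Fin n) (Fin n) ℂ) (hp : IsOrthProjOnto p B) :
    hsPerp (D : Set (Matrix (Fin 2) (Fin n) ℂ)) =
      Submodule.span ℂ {W | W ∈ hsPerp (D : Set (Matrix (Fin 2) (Fin n) ℂ)) ∧ W.rank ≤ 1} ↔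
    ∀ b ∈ D ⊓ hsPerp {V | V ∈ D ∧ V.rank ≤ 1}, (b * (1 - p)).rank ≠ 1 := by
  obtain ⟨hherm, hidem, -, -⟩ := id hp
  have hvec (r : Fin n → ℂ) (hr : r ᵥ* p = r) : vecMulVec α r ∈ D := by
    have : vecMulVec α r ∈ {V | V ∈ D ∧ V.rank ≤ 1} := by
      rw [hD1]
      exact ⟨star r, (hp.star_mem_iff r).mpr hr, by rw [star_star]⟩
    exact this.1
  have hrank (M : Matrix (Fin 2) (Fin n) ℂ) (hM : M ∈ D) (hr : M.rank ≤ 1) :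
      ∃ r, M = vecMulVec α r ∧ r ᵥ* p = r := by
    have : M ∈ {V | V ∈ D ∧ V.rank ≤ 1} := ⟨hM, hr⟩
    rw [hD1] at this
    obtain ⟨η, hη, rfl⟩ := this
    exact ⟨star η, rfl, (hp.star_mem_iff _).mp (by rwa [star_star])⟩
  have hpp : p * (1 - p) = 0 := by rw [mul_sub, mul_one, hidem, sub_self]
  have hαα : star α ⬝ᵥ α ≠ 0 := mt dotProduct_star_self_eq_zero.mp hα
  let y : Fin 2 → ℂ := ![α 1, -α 0]
  have hyα : y ⬝ᵥ α = 0 := by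
    simp [y, dotProduct, Fin.sum_univ_two, mul_comm]
  have hy (Y : Matrix (Fin 2) (Fin n) ℂ) (h : y ᵥ* Y = 0) : ∃ r, Y = vecMulVec α r :=
    exists_eq_vecMulVec_of_mul_eq hα fun j => by
      have := congrFun h j
      simp [y, vecMul, dotProduct, Fin.sum_univ_two] at this
      linear_combination this
  have hy_rank (M : Matrix (Fin 2) (Fin n) ℂ) (hM : M ∈ D) (hr : M.rank ≤ 1) : y ᵥ* M = 0 := by
    obtain ⟨r, rfl, -⟩ := hrank M hM hr
    rw [vecMul_vecMulVec, hyα, zero_smul]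
  have hsub (r : Fin n → ℂ) (h : vecMulVec α r * (1 - p) = 0) : r ᵥ* p = r := by
    have := congrArg (star α ᵥ* ·) h
    simp only [vecMulVec_mul, vecMul_vecMulVec, vecMul_zero, smul_eq_zero, hαα, false_or,
      vecMul_sub, vecMul_one, sub_eq_zero] at this
    exact this.symm
  have hv0 : vecMulVec α (0 : Fin n → ℂ) = 0 := by ext; simp [vecMulVec_apply]
  constructor
  · rintro hspan b ⟨hbD, -⟩ hb
    obtain ⟨ξ, ρ, hX⟩ := exists_eq_vecMulVec_of_rank_le_one hb.le
    have hyX : y ᵥ* (b * (1 - p)) = 0 := by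
      rw [hX, vecMul_vecMulVec]
      by_cases hyξ : y ⬝ᵥ ξ = 0
      · rw [hyξ, zero_smul]
      have hyb : y ᵥ* (b * (1 - p)) = (y ⬝ᵥ ξ) • ρ := by rw [hX, vecMul_vecMulVec]
      let Z := vecMulVec ξ ((y ⬝ᵥ ξ)⁻¹ • (y ᵥ* b))
      have hyZ : y ᵥ* Z = y ᵥ* b := by
        rw [vecMul_vecMulVec, smul_smul, mul_inv_cancel₀ hyξ, one_smul]
      obtain ⟨r, hr⟩ := hy (Z - b) (by rw [vecMul_sub, hyZ, sub_self])
      have hrp : r ᵥ* p = r := hsub r (by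
        rw [← hr, Matrix.sub_mul, vecMulVec_mul, smul_vecMul, vecMul_vecMul, hyb, smul_smul,
          inv_mul_cancel₀ hyξ, one_smul, hX, sub_self])
      have hZ : Z ∈ D := by
        rw [← sub_add_cancel Z b, hr]
        exact D.add_mem (hvec r hrp) hbD
      rw [← hyb, ← vecMul_vecMul, ← hyZ, hy_rank Z hZ (rank_vecMulVec_le _ _), zero_vecMul]
    have hbX : IsRowwiseIn D (b * (1 - p)) := fun x => by
      by_cases hxα : x ⬝ᵥ α = 0
      · refine ⟨0, D.zero_mem, ?_⟩
        obtain ⟨r, hr⟩ := hy _ hyX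
        rw [hr, vecMul_vecMulVec, hxα, zero_smul, vecMul_zero]
      · refine ⟨b - vecMulVec α ((x ⬝ᵥ α)⁻¹ • (x ᵥ* b ᵥ* p)), D.sub_mem hbD (hvec _ ?_), ?_⟩
        · rw [smul_vecMul, vecMul_vecMul, hidem]
        · rw [vecMul_sub, vecMul_vecMulVec, smul_smul, mul_inv_cancel₀ hxα, one_smul,
            Matrix.mul_sub, Matrix.mul_one, vecMul_sub, vecMul_vecMul]
    obtain ⟨r, hr, hrp⟩ := hrank _ (hbX.mem_of_eq_span hspan) hb.le
    have : b * (1 - p) = 0 := by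
      calc b * (1 - p) = b * (1 - p) * (1 - p) := by
            rw [Matrix.mul_assoc, sub_mul 1 p, hpp, one_mul, sub_zero]
        _ = 0 := by rw [hr, vecMulVec_mul, vecMul_sub, vecMul_one, hrp, sub_self, hv0]
    simp [this] at hb
  · intro hnone
    have hE : ∀ d ∈ D, (d * (1 - p)).rank ≤ 1 → d * (1 - p) = 0 := by
      intro d hd hr
      let r : Fin n → ℂ := (star α ⬝ᵥ α)⁻¹ • (star α ᵥ* d ᵥ* p)
      have hrp : r ᵥ* p = r := by simp only [r]; rw [smul_vecMul, vecMul_vecMul, hidem]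
      have hd' : (d - vecMulVec α r) * (1 - p) = d * (1 - p) := by
        rw [Matrix.sub_mul, vecMulVec_mul, vecMul_sub, vecMul_one, hrp, sub_self,
          hv0, sub_zero]
      have hb := hnone (d - vecMulVec α r) ⟨D.sub_mem hd (hvec r hrp), fun V hV => by
        obtain ⟨s, rfl, hs⟩ := hrank V hV.1 hV.2
        rw [sum_star_vecMulVec_mul, vecMul_sub, vecMul_vecMulVec, smul_smul,
          mul_inv_cancel₀ hαα, one_smul]
        have : star s = p *ᵥ star s := by
          conv_lhs => rw [← hs, star_vecMul, hherm]
        rw [this, dotProduct_mulVec, sub_vecMul, vecMul_vecMul, vecMul_vecMul,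
          Matrix.mul_assoc, hidem, sub_self, zero_dotProduct]⟩
      rw [hd'] at hb
      have h0 : (d * (1 - p)).rank = 0 := by omega
      exact eq_zero_of_rank_eq_zero h0
    have hyd : ∀ d ∈ D, d * (1 - p) = 0 → y ᵥ* d = 0 := by
      intro d hd h
      have hdp : d * p = d := by
        rw [Matrix.mul_sub, Matrix.mul_one, sub_eq_zero] at h
        exact h.symm
      let r : Fin n → ℂ := (star α ⬝ᵥ α)⁻¹ • (star α ᵥ* d)
      have hrp : r ᵥ* p = r := by simp only [r]; rw [smul_vecMul, vecMul_vecMul, hdp]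
      have := hy_rank (d - vecMulVec α r) (D.sub_mem hd (hvec r hrp))
        (rank_le_one_of_vecMul_eq_zero (x := star α) (by simpa using hα) (by
          rw [vecMul_sub, vecMul_vecMulVec, smul_smul, mul_inv_cancel₀ hαα, one_smul, sub_self]))
      rwa [vecMul_sub, vecMul_vecMulVec, hyα, zero_smul, sub_zero] at this
    refine eq_span_of_forall_isRowwiseIn fun X hX => ?_
    have hXE : X * (1 - p) ∈ D.map (mulRightLinearMap (Fin 2) ℂ (1 - p)) := by
      refine IsRowwiseIn.mem_of_forall_rank ?_ fun x => ?_
      · rintro _ ⟨d, hd, rfl⟩ hr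
        exact hE d hd hr
      · obtain ⟨d, hd, h⟩ := hX x
        exact ⟨_, ⟨d, hd, rfl⟩, by
          rw [mulRightLinearMap_apply, ← vecMul_vecMul, h, vecMul_vecMul]⟩
    obtain ⟨d, hd, hXd⟩ := hXE
    rw [mulRightLinearMap_apply] at hXd
    have hY0 : (X - d) * (1 - p) = 0 := by rw [Matrix.sub_mul, hXd, sub_self]
    obtain ⟨d', hd', h⟩ := hX.sub hd y
    have hyd' : y ᵥ* (d' * (1 - p)) = 0 := by
      rw [← vecMul_vecMul, ← h, vecMul_vecMul, hY0, vecMul_zero]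
    have hy0 : y ≠ 0 := fun h' => hα (by
      have h0 := congrFun h' 0
      have h1 := congrFun h' 1
      ext i
      fin_cases i <;> simp_all [y])
    rw [hyd d' hd' (hE d' hd' (rank_le_one_of_vecMul_eq_zero hy0 hyd'))] at h
    obtain ⟨r, hr⟩ := hy _ h
    rw [hr] at hY0
    have := D.add_mem (hvec r (hsub r hY0)) hd
    rwa [← hr, sub_add_cancel] at this

end
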